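/- For v_0 = 2/3 and v_1 = 1, the maximum, over all pure local strategy profiles that are Nash equilibria of NC_01(C_5) with the uniform type distribution, of the social welfare (the average over the 5 players of their expected payoffs) equals 7/9. -/

import Mathlib

open Finset

/-- The 6 types of `NC₀₁(C₅)`: `none` is `Tₐ = 11111`; `some i` is the type `Tᵢ`
giving type bit 1 to players `i` and `i + 2` and 0 to the others. -/
abbrev C5Type := Option (ZMod 5)

/-- Type bit of player `j` in type `t` of `NC₀₁(C₅)`. -/
def inputBit01 : C5Type → ZMod 5 → ZMod 2
  | none, _ => 1
  | some i, j => if j = i ∨ j = i + 2 then 1 else 0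

/-- The involved set of type `t`: all five players for `Tₐ`;
`{i-1, i, i+1}` for `Tᵢ`. -/
def involvedSet : C5Type → Finset (ZMod 5)
  | none => Finset.univ
  | some i => {i - 1, i, i + 1}

/-- The target parity bit of type `t`: `1` for `Tₐ` and `0` for each `Tᵢ`. -/
def targetBit : C5Type → ZMod 2
  | none => 1
  | some _ => 0

/-- Payoff of player `j` on (answer profile `s`, type `t`) in `NC₀₁(C₅)`:
`v_{s j}` if `s` wins on `t`, else `0`. -/
noncomputable def payoffOf (v0 v1 : ℝ) (j : ZMod 5) (s : ZMod 5 → ZMod 2)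
    (t : C5Type) : ℝ :=
  if ∑ k ∈ involvedSet t, s k = targetBit t then (if s j = 1 then v1 else v0) else 0

/-- Expected payoff of player `j` under the pure local strategy profile `f`
(player `i` answers `f i b` on type bit `b`), with the type uniform on the 6 types. -/
noncomputable def pureUtil (v0 v1 : ℝ) (f : ZMod 5 → ZMod 2 → ZMod 2) (j : ZMod 5) : ℝ :=
  (∑ t : C5Type, payoffOf v0 v1 j (fun i => f i (inputBit01 t i)) t) / 6

/-- The pure local strategy profile `f` is a Nash equilibrium of `NC₀₁(C₅)` with
the uniform type distribution: no player can strictly increase their expected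
payoff by unilaterally replacing their local function. -/
def IsNashEq (v0 v1 : ℝ) (f : ZMod 5 → ZMod 2 → ZMod 2) : Prop :=
  ∀ (i : ZMod 5) (g : ZMod 2 → ZMod 2),
    pureUtil v0 v1 (Function.update f i g) i ≤ pureUtil v0 v1 f i

/-- Eighteen times the expected payoff of player `j` at `v₀ = 2/3`, `v₁ = 1`, as a natural number. -/
def scaledUtil (f : ZMod 5 → ZMod 2 → ZMod 2) (j : ZMod 5) : ℕ :=
  ∑ t : C5Type, if ∑ k ∈ involvedSet t, f k (inputBit01 t k) = targetBit t then
    (if f j (inputBit01 t j) = 1 then 3 else 2) else 0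

theorem pureUtil_eq_scaledUtil_div (f : ZMod 5 → ZMod 2 → ZMod 2) (j : ZMod 5) :
    pureUtil (2/3) 1 f j = (scaledUtil f j : ℝ) / 18 := by
  have h : ∑ t : C5Type, payoffOf (2/3) 1 j (fun i => f i (inputBit01 t i)) t
      = (scaledUtil f j : ℝ) / 3 := by
    rw [scaledUtil, Nat.cast_sum, Finset.sum_div]
    refine Finset.sum_congr rfl fun t _ => ?_
    unfold payoffOf
    split_ifs <;> norm_num
  rw [pureUtil, h]
  ring

theorem welfare_eq_scaledUtil_div (f : ZMod 5 → ZMod 2 → ZMod 2) :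
    (∑ j : ZMod 5, pureUtil (2/3) 1 f j) / 5 = ((∑ j, scaledUtil f j : ℕ) : ℝ) / 90 := by
  simp only [pureUtil_eq_scaledUtil_div]
  rw [← Finset.sum_div, Nat.cast_sum]
  ring

theorem isNashEq_iff_scaledUtil (f : ZMod 5 → ZMod 2 → ZMod 2) :
    IsNashEq (2/3) 1 f ↔ ∀ (i : ZMod 5) (g : ZMod 2 → ZMod 2),
      scaledUtil (Function.update f i g) i ≤ scaledUtil f i := by
  refine forall₂_congr fun i g => ?_
  rw [pureUtil_eq_scaledUtil_div, pureUtil_eq_scaledUtil_div,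
    div_le_div_iff_of_pos_right (by norm_num), Nat.cast_le]

/-- Eighteen times the total expected payoff of the five players. -/
theorem sum_scaledUtil (f : ZMod 5 → ZMod 2 → ZMod 2) :
    ∑ j, scaledUtil f j = ∑ t : C5Type,
      if ∑ k ∈ involvedSet t, f k (inputBit01 t k) = targetBit t then
        10 + ∑ j, (f j (inputBit01 t j)).val else 0 := by
  have hval (x : ZMod 2) : (if x = 1 then 3 else 2) = 2 + x.val := by
    revert x
    decide
  unfold scaledUtil
  rw [Finset.sum_comm]
  refine Finset.sum_congr rfl fun t _ => ?_
  split_ifs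
  · simp [hval, Finset.sum_add_distrib]
  · simp

/-- Scaled total payoff on a type with target bit 0 and involved answers `x`, `y`, `z`. -/
def tripleScore (x y z u v : ZMod 2) : ℕ :=
  if x + y + z = 0 then 10 + (x.val + y.val + z.val + u.val + v.val) else 0

/-- Scaled total payoff on the type with target bit 1 and all players involved. -/
def fullScore (x y z u v : ZMod 2) : ℕ :=
  if x + y + z + u + v = 1 then 10 + (x.val + y.val + z.val + u.val + v.val) else 0

theorem sum_score_le : ∀ a0 a1 a2 a3 a4 b0 b1 b2 b3 b4 : ZMod 2,
    fullScore b0 b1 b2 b3 b4 + (tripleScore a4 b0 a1 b2 a3 +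
      tripleScore a0 b1 a2 b3 a4 +
      tripleScore a1 b2 a3 b4 a0 +
      tripleScore a2 b3 a4 b0 a1 +
      tripleScore a3 b4 a0 b1 a2) ≤ 70 := by
  decide +kernel

theorem sum_zmod_five {M : Type*} [AddCommMonoid M] (g : ZMod 5 → M) :
    ∑ j, g j = g 0 + g 1 + g 2 + g 3 + g 4 :=
  Fin.sum_univ_five g

theorem sum_involvedSet_some {M : Type*} [AddCommMonoid M] (g : ZMod 5 → M) (i : ZMod 5) :
    ∑ k ∈ involvedSet (some i), g k = g (i - 1) + g i + g (i + 1) := by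
  have h₁ : ∀ i : ZMod 5, i - 1 ∉ ({i, i + 1} : Finset (ZMod 5)) := by decide
  have h₂ : ∀ i : ZMod 5, i ∉ ({i + 1} : Finset (ZMod 5)) := by decide
  rw [involvedSet, Finset.sum_insert (h₁ i), Finset.sum_insert (h₂ i), Finset.sum_singleton,
    add_assoc]

theorem sum_univ_eq_cyclic (g : ZMod 5 → ℕ) (i : ZMod 5) :
    ∑ j, g j = g (i - 1) + g i + g (i + 1) + g (i + 2) + g (i + 3) := by
  rw [← Equiv.sum_comp (Equiv.addLeft (i - 1)) g, sum_zmod_five]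
  have h : ∀ i : ZMod 5, i - 1 + 0 = i - 1 ∧ i - 1 + 1 = i ∧ i - 1 + 2 = i + 1 ∧
      i - 1 + 3 = i + 2 ∧ i - 1 + 4 = i + 3 := by decide
  obtain ⟨h₀, h₁, h₂, h₃, h₄⟩ := h i
  simp only [Equiv.coe_addLeft, h₀, h₁, h₂, h₃, h₄]

theorem typeScore_some (f : ZMod 5 → ZMod 2 → ZMod 2) (i : ZMod 5) :
    (if ∑ k ∈ involvedSet (some i), f k (inputBit01 (some i) k) = targetBit (some i) then
      10 + ∑ j, (f j (inputBit01 (some i) j)).val else 0) =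
    tripleScore (f (i - 1) 0) (f i 1) (f (i + 1) 0) (f (i + 2) 1) (f (i + 3) 0) := by
  have h : ∀ i : ZMod 5, inputBit01 (some i) (i - 1) = 0 ∧ inputBit01 (some i) i = 1 ∧
      inputBit01 (some i) (i + 1) = 0 ∧ inputBit01 (some i) (i + 2) = 1 ∧
      inputBit01 (some i) (i + 3) = 0 := by decide
  obtain ⟨h₀, h₁, h₂, h₃, h₄⟩ := h i
  rw [sum_involvedSet_some, sum_univ_eq_cyclic _ i, h₀, h₁, h₂, h₃, h₄]
  rfl

theorem typeScore_none (f : ZMod 5 → ZMod 2 → ZMod 2) :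
    (if ∑ k ∈ involvedSet none, f k (inputBit01 none k) = targetBit none then
      10 + ∑ j, (f j (inputBit01 none j)).val else 0) =
    fullScore (f 0 1) (f 1 1) (f 2 1) (f 3 1) (f 4 1) := by
  rw [involvedSet, sum_zmod_five, sum_zmod_five]
  rfl

/-- The welfare bound holds for every profile, in equilibrium or not. -/
theorem sum_scaledUtil_le (f : ZMod 5 → ZMod 2 → ZMod 2) : ∑ j, scaledUtil f j ≤ 70 := by
  rw [sum_scaledUtil, Fintype.sum_option, typeScore_none]
  simp only [typeScore_some]
  rw [sum_zmod_five]
  exact sum_score_le (f 0 0) (f 1 0) (f 2 0) (f 3 0) (f 4 0)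
    (f 0 1) (f 1 1) (f 2 1) (f 3 1) (f 4 1)

/-- Players 0 and 1 answer their type bit; the others always answer 1. -/
def optimalProfile (i : ZMod 5) (b : ZMod 2) : ZMod 2 :=
  if i = 0 ∨ i = 1 then b else 1

theorem isNashEq_optimalProfile : IsNashEq (2/3) 1 optimalProfile := by
  rw [isNashEq_iff_scaledUtil]
  decide +kernel

theorem sum_scaledUtil_optimalProfile : ∑ j, scaledUtil optimalProfile j = 70 := by
  decide +kernel

/-- **Best classical social welfare of `NC₀₁(C₅)` at `v0 = 2/3`, `v1 = 1` is `7/9`.**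
The maximum, over pure local strategy profiles that are Nash equilibria of
`NC₀₁(C₅)` with the uniform type distribution, of the social welfare (the average
over the 5 players of their expected payoffs) equals `7/9`. -/
theorem best_nash_social_welfare_NC01 :
    IsGreatest {x : ℝ | ∃ f : ZMod 5 → ZMod 2 → ZMod 2,
        IsNashEq (2/3) 1 f ∧ x = (∑ j : ZMod 5, pureUtil (2/3) 1 f j) / 5}
      (7 / 9) := by
  refine ⟨⟨optimalProfile, isNashEq_optimalProfile, ?_⟩, ?_⟩
  · rw [welfare_eq_scaledUtil_div, sum_scaledUtil_optimalProfile]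
    norm_num
  · rintro x ⟨f, -, rfl⟩
    have h : ((∑ j, scaledUtil f j : ℕ) : ℝ) ≤ 70 := by exact_mod_cast sum_scaledUtil_le f
    rw [welfare_eq_scaledUtil_div]
    linarith
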